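/- All components h̄_{μν} of the Blanchet–Damour field are C^∞ on ℝ × ℝ³, each satisfies the flat wave equation ∂_t² h̄_{μν} = Σ_{i=1}^{3} ∂_i² h̄_{μν}, and the harmonic (de Donder) gauge conditions hold: ∂_t h̄_{tt} = Σ_i ∂_i h̄_{it} and, for each k, ∂_t h̄_{tk} = Σ_i ∂_i h̄_{ik} (i.e. ∂_μ h̄^{μν} = 0 for the Minkowski metric diag(−1,1,1,1)). Thus the Blanchet–Damour fields are smooth solutions of the linearised vacuum Einstein equations on Minkowski spacetime in harmonic coordinates. -/

import Mathlib

noncomputable section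

open scoped BigOperators

/-- Euclidean `ℝ³`. -/
abbrev E3 := EuclideanSpace ℝ (Fin 3)

/-- Directional (coordinate) derivative of a function on `ℝ³` along the `i`-th
coordinate direction. -/
def pdE (i : Fin 3) (g : E3 → ℝ) (x : E3) : ℝ :=
  deriv (fun s : ℝ => g (x + s • EuclideanSpace.single i (1:ℝ))) 0

open Classical in
/-- The spherical wave associated with a function `f : ℝ → ℝ`:
`u(t,x) = (f(t−‖x‖) − f(t+‖x‖))/‖x‖` for `x ≠ 0` and `u(t,0) = −2f′(t)`. -/
def sphericalWave (f : ℝ → ℝ) (t : ℝ) (x : E3) : ℝ :=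
  if x = 0 then -2 * deriv f t else (f (t - ‖x‖) - f (t + ‖x‖)) / ‖x‖

/-- Time derivative of a function of `(t, x)`. -/
def pdT (u : ℝ → E3 → ℝ) : ℝ → E3 → ℝ := fun t x => deriv (fun s => u s x) t

/-- Spatial derivative of a function of `(t, x)` along coordinate `i`. -/
def pdX (i : Fin 3) (u : ℝ → E3 → ℝ) : ℝ → E3 → ℝ := fun t x => pdE i (u t) x

/-- Spherical waves `F_{ij}` built from a family `I` of matrices. -/
def BDF (I : ℝ → Fin 3 → Fin 3 → ℝ) (i j : Fin 3) : ℝ → E3 → ℝ :=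
  sphericalWave (fun s => I s i j)

/-- Blanchet–Damour component `h̄_{tt} = Σ_{i,j} ∂ᵢ∂ⱼ F_{ij}`. -/
def BDtt (I : ℝ → Fin 3 → Fin 3 → ℝ) : ℝ → E3 → ℝ :=
  fun t x => ∑ i, ∑ j, pdX i (pdX j (BDF I i j)) t x

/-- Blanchet–Damour component `h̄_{tj} = h̄_{jt} = Σᵢ ∂ᵢ∂ₜ F_{ij}`. -/
def BDtj (I : ℝ → Fin 3 → Fin 3 → ℝ) (j : Fin 3) : ℝ → E3 → ℝ :=
  fun t x => ∑ i, pdX i (pdT (BDF I i j)) t x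

/-- Blanchet–Damour component `h̄_{jk} = ∂ₜ² F_{jk}`. -/
def BDjk (I : ℝ → Fin 3 → Fin 3 → ℝ) (j k : Fin 3) : ℝ → E3 → ℝ :=
  pdT (pdT (BDF I j k))

open scoped ContDiff

/-- Differentiation under the integral sign for a jointly continuous derivative. -/
theorem hasFDerivAt_intervalIntegral_of_continuous {H : Type*} [NormedAddCommGroup H]
    [NormedSpace ℝ H] [ProperSpace H] {F : H → ℝ → ℝ} {F' : H → ℝ → H →L[ℝ] ℝ} {a b : ℝ}
    (hF : Continuous (Function.uncurry F)) (hF' : Continuous (Function.uncurry F'))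
    (hd : ∀ q s, HasFDerivAt (fun q => F q s) (F' q s) q) (q : H) :
    HasFDerivAt (fun q => ∫ s in a..b, F q s) (∫ s in a..b, F' q s) q := by
  obtain ⟨C, hC⟩ := ((isCompact_closedBall q 1).prod (isCompact_uIcc (a := a) (b := b)))
    |>.exists_bound_of_continuousOn hF'.continuousOn
  have hFq : ∀ x, Continuous (F x) := fun x => hF.comp (by fun_prop : Continuous fun s => (x, s))
  have hFq' : Continuous (F' q) := hF'.comp (by fun_prop : Continuous fun s => (q, s))
  refine intervalIntegral.hasFDerivAt_integral_of_dominated_of_fderiv_le (bound := fun _ => C)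
    (Metric.closedBall_mem_nhds q one_pos)
    (.of_forall fun x => (hFq x).aestronglyMeasurable) ((hFq q).intervalIntegrable _ _)
    hFq'.aestronglyMeasurable (.of_forall fun s hs x hx => ?_) intervalIntegrable_const
    (.of_forall fun s _ x _ => hd x s)
  exact hC (x, s) ⟨hx, Set.uIoc_subset_uIcc hs⟩

/-- The weighted mean `∫_{-1}^1 (1 - s²)^k f(t + s r) ds`. -/
def weightedMean (k : ℕ) (f : ℝ → ℝ) (t r : ℝ) : ℝ :=
  ∫ s in (-1 : ℝ)..1, (1 - s ^ 2) ^ k * f (t + s * r)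

theorem continuous_weightedMean (k : ℕ) {f : ℝ → ℝ} (hf : Continuous f) :
    Continuous fun q : ℝ × ℝ => weightedMean k f q.1 q.2 :=
  intervalIntegral.continuous_parametric_intervalIntegral_of_continuous' (by fun_prop) _ _

/-- Integration by parts against a weight vanishing at both endpoints. -/
theorem mul_integral_weight_mul_deriv {p p' f : ℝ → ℝ} (hp : ∀ s, HasDerivAt p (p' s) s)
    (hp' : Continuous p') (h1 : p 1 = 0) (h2 : p (-1) = 0) (hf : ContDiff ℝ 1 f) (t r : ℝ) :
    r * ∫ s in (-1 : ℝ)..1, p s * deriv f (t + s * r) =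
      -∫ s in (-1 : ℝ)..1, p' s * f (t + s * r) := by
  have hc : Continuous (deriv f) := hf.continuous_deriv le_rfl
  have hv : ∀ s, HasDerivAt (fun s => f (t + s * r)) (deriv f (t + s * r) * r) s := fun s =>
    ((hf.differentiable one_ne_zero) _).hasDerivAt.comp s
      (by simpa using ((hasDerivAt_id s).mul_const r).const_add t)
  have h := intervalIntegral.integral_mul_deriv_eq_deriv_mul (a := -1) (b := 1)
    (fun s _ => hp s) (fun s _ => hv s) (hp'.intervalIntegrable _ _)
    ((by fun_prop : Continuous fun s => deriv f (t + s * r) * r).intervalIntegrable _ _)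
  simp only [h1, h2, zero_mul, sub_zero, zero_sub] at h
  rw [← h, ← intervalIntegral.integral_const_mul]
  exact intervalIntegral.integral_congr fun s _ => by ring

theorem hasDerivAt_one_sub_sq_pow (k : ℕ) (s : ℝ) :
    HasDerivAt (fun s : ℝ => (1 - s ^ 2) ^ (k + 1)) (-(2 * (k + 1)) * (s * (1 - s ^ 2) ^ k)) s := by
  convert! ((hasDerivAt_pow 2 s).const_sub 1).fun_pow (k + 1) using 1
  push_cast
  ring

/-- The odd moment occurring in the radial derivative of a weighted mean. -/
theorem integral_mul_weight_deriv (k : ℕ) {f : ℝ → ℝ} (hf : ContDiff ℝ 1 f) (t r : ℝ) :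
    ∫ s in (-1 : ℝ)..1, s * (1 - s ^ 2) ^ k * f (t + s * r) =
      r * ((2 * (k + 1) : ℝ)⁻¹ * weightedMean (k + 1) (deriv f) t r) := by
  have h := mul_integral_weight_mul_deriv (hasDerivAt_one_sub_sq_pow k) (by fun_prop)
    (by simp) (by simp) hf t r
  have hk : (2 * (k + 1) : ℝ) ≠ 0 := by positivity
  rw [mul_left_comm, weightedMean, h, ← intervalIntegral.integral_neg,
    ← intervalIntegral.integral_const_mul]
  refine intervalIntegral.integral_congr fun s _ => ?_
  field_simp

/-- The recursion between weighted means encoding the radial wave equation. -/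
theorem sq_mul_weightedMean_two {f : ℝ → ℝ} (hf : ContDiff ℝ 2 f) (t r : ℝ) :
    r ^ 2 * weightedMean 2 (deriv (deriv f)) t r =
      8 * weightedMean 0 f t r - 12 * weightedMean 1 f t r := by
  have hf1 : ContDiff ℝ 1 f := hf.of_le (by norm_num)
  have hf' : ContDiff ℝ 1 (deriv f) := hf.deriv'
  have hc := hf.continuous
  have h1 := integral_mul_weight_deriv 1 hf' t r
  have hp : ∀ s : ℝ, HasDerivAt (fun s : ℝ => s * (1 - s ^ 2) ^ 1) (1 - 3 * s ^ 2) s := fun s => by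
    convert! (hasDerivAt_id s).mul (((hasDerivAt_pow 2 s).const_sub 1).fun_pow 1) using 1
    simp
    ring
  have h2 := mul_integral_weight_mul_deriv hp (by fun_prop) (by simp) (by simp) hf1 t r
  have h3 : ∫ s in (-1 : ℝ)..1, (1 - 3 * s ^ 2) * f (t + s * r) =
      3 * weightedMean 1 f t r - 2 * weightedMean 0 f t r := by
    rw [weightedMean, weightedMean, ← intervalIntegral.integral_const_mul,
      ← intervalIntegral.integral_const_mul, ← intervalIntegral.integral_sub
        (Continuous.intervalIntegrable (by fun_prop) _ _)
        (Continuous.intervalIntegrable (by fun_prop) _ _)]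
    exact intervalIntegral.integral_congr fun s _ => by ring
  rw [h1, h3] at h2
  norm_num at h2
  linarith

theorem hasFDerivAt_weightedMean (k : ℕ) {f : ℝ → ℝ} (hf : ContDiff ℝ 2 f) (q : ℝ × ℝ) :
    HasFDerivAt (fun q : ℝ × ℝ => weightedMean k f q.1 q.2)
      (weightedMean k (deriv f) q.1 q.2 • ContinuousLinearMap.fst ℝ ℝ ℝ +
        (q.2 * ((2 * (k + 1) : ℝ)⁻¹ * weightedMean (k + 1) (deriv (deriv f)) q.1 q.2)) •
          ContinuousLinearMap.snd ℝ ℝ ℝ) q := by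
  have hf' : ContDiff ℝ 1 (deriv f) := hf.deriv'
  have hc := hf.continuous
  have hc' := hf'.continuous
  convert! hasFDerivAt_intervalIntegral_of_continuous
    (F := fun q s => (1 - s ^ 2) ^ k * f (q.1 + s * q.2))
    (F' := fun q s => ((1 - s ^ 2) ^ k * deriv f (q.1 + s * q.2)) • ContinuousLinearMap.fst ℝ ℝ ℝ +
      (s * (1 - s ^ 2) ^ k * deriv f (q.1 + s * q.2)) • ContinuousLinearMap.snd ℝ ℝ ℝ)
    (by fun_prop) (by fun_prop) (fun q s => ?_) q using 1
  · rw [← integral_mul_weight_deriv k hf', weightedMean,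
      intervalIntegral.integral_add (Continuous.intervalIntegrable (by fun_prop) _ _)
        (Continuous.intervalIntegrable (by fun_prop) _ _),
      intervalIntegral.integral_smul_const, intervalIntegral.integral_smul_const]
  · have hl : HasFDerivAt (fun q : ℝ × ℝ => q.1 + s * q.2)
        (ContinuousLinearMap.fst ℝ ℝ ℝ + s • ContinuousLinearMap.snd ℝ ℝ ℝ) q :=
      hasFDerivAt_fst.add (hasFDerivAt_snd.const_mul s)
    have := (((hf.differentiable two_ne_zero) (q.1 + s * q.2)).hasDerivAt.comp_hasFDerivAt q
      hl).const_mul ((1 - s ^ 2) ^ k)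
    convert! this using 1
    ext <;> simp
    ring

theorem hasFDerivAt_weightedMean_norm (k : ℕ) {f : ℝ → ℝ} (hf : ContDiff ℝ 2 f) (p : ℝ × E3) :
    HasFDerivAt (fun p : ℝ × E3 => weightedMean k f p.1 ‖p.2‖)
      (weightedMean k (deriv f) p.1 ‖p.2‖ • ContinuousLinearMap.fst ℝ ℝ E3 +
        ((2 * (k + 1) : ℝ)⁻¹ * weightedMean (k + 1) (deriv (deriv f)) p.1 ‖p.2‖) •
          (innerSL ℝ p.2).comp (ContinuousLinearMap.snd ℝ ℝ E3)) p := by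
  have h := hasFDerivAt_weightedMean k hf (p.1, ‖p.2‖)
  rcases eq_or_ne p.2 0 with h0 | h0
  · -- The radial derivative vanishes here, so the norm need not be differentiable.
    have hlim : Filter.Tendsto (fun y : ℝ × E3 => (y.1, ‖y.2‖)) (nhds p) (nhds (p.1, ‖p.2‖)) :=
      (by fun_prop : Continuous fun y : ℝ × E3 => (y.1, ‖y.2‖)).tendsto p
    refine .of_isLittleO ?_
    refine ((h.isLittleO.comp_tendsto hlim).congr_left fun y => ?_).trans_isBigO
      (Asymptotics.isBigO_of_le _ fun y => ?_)
    · simp [h0]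
    · simp [h0, Prod.norm_def]
  · have hn : HasFDerivAt (fun y : ℝ × E3 => ‖y.2‖)
        ((‖p.2‖⁻¹ • innerSL ℝ p.2).comp (ContinuousLinearMap.snd ℝ ℝ E3)) p := by
      have hs := (hasFDerivAt_snd (𝕜 := ℝ) (p := p)).norm_sq.sqrt (by positivity)
      simp only [Real.sqrt_sq (norm_nonneg _)] at hs
      convert! hs using 1
      ext <;> simp
      ring
    convert! h.comp p (hasFDerivAt_fst.prodMk hn) using 1
    have : ‖p.2‖ ≠ 0 := norm_ne_zero_iff.2 h0
    ext
    · simp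
    · simp
      field_simp

theorem contDiff_weightedMean_norm (k : ℕ) {f : ℝ → ℝ} (hf : ContDiff ℝ ∞ f) :
    ContDiff ℝ ∞ fun p : ℝ × E3 => weightedMean k f p.1 ‖p.2‖ := by
  refine contDiff_infty.2 fun n => ?_
  induction n generalizing k f with
  | zero =>
    exact contDiff_zero.2 ((continuous_weightedMean k hf.continuous).comp
      (by fun_prop : Continuous fun p : ℝ × E3 => (p.1, ‖p.2‖)))
  | succ n ih =>
    have hf' := (contDiff_infty_iff_deriv.1 hf).2
    have hf'' := (contDiff_infty_iff_deriv.1 hf').2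
    refine contDiff_succ_iff_hasFDerivAt.2 ⟨_, ?_, hasFDerivAt_weightedMean_norm k
      (contDiff_infty.1 hf 2)⟩
    exact ((ih k hf').smul contDiff_const).add ((contDiff_const.mul (ih (k + 1) hf'')).smul
      (((innerSL ℝ).contDiff.comp contDiff_snd).clm_comp contDiff_const))

theorem sphericalWave_eq_neg_weightedMean {f : ℝ → ℝ} (hf : ContDiff ℝ 1 f) :
    sphericalWave f = fun t x => -weightedMean 0 (deriv f) t ‖x‖ := by
  funext t x
  rcases eq_or_ne x 0 with rfl | hx
  · norm_num [sphericalWave, weightedMean]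
  · have hn : ‖x‖ ≠ 0 := norm_ne_zero_iff.2 hx
    have h : ∫ s in (-1 : ℝ)..1, deriv f (t + s * ‖x‖) * ‖x‖ =
        f (t + 1 * ‖x‖) - f (t + -1 * ‖x‖) := by
      refine intervalIntegral.integral_eq_sub_of_hasDerivAt (f := fun s => f (t + s * ‖x‖))
        (fun s _ => ?_) ?_
      · exact ((hf.differentiable one_ne_zero) _).hasDerivAt.comp s
          (by simpa using ((hasDerivAt_id s).mul_const ‖x‖).const_add t)
      · have := hf.continuous_deriv le_rfl
        exact Continuous.intervalIntegrable (by fun_prop) _ _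
    rw [intervalIntegral.integral_mul_const] at h
    simp only [sphericalWave, if_neg hx, weightedMean, pow_zero, one_mul]
    rw [div_eq_iff hn, neg_mul, h]
    ring_nf

theorem hasDerivAt_weightedMean_norm_coord (k : ℕ) {f : ℝ → ℝ} (hf : ContDiff ℝ 2 f) (t : ℝ)
    (x : E3) (i : Fin 3) :
    HasDerivAt (fun s : ℝ => weightedMean k f t ‖x + s • EuclideanSpace.single i (1 : ℝ)‖)
      (x i * ((2 * (k + 1) : ℝ)⁻¹ * weightedMean (k + 1) (deriv (deriv f)) t ‖x‖)) 0 := by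
  have hl : HasDerivAt (fun s : ℝ => (t, x + s • EuclideanSpace.single i (1 : ℝ)))
      (0, EuclideanSpace.single i (1 : ℝ)) 0 :=
    (hasDerivAt_const _ _).prodMk
      (by simpa using ((hasDerivAt_id (0 : ℝ)).smul_const
        (EuclideanSpace.single i (1 : ℝ))).const_add x)
  have h := (hasFDerivAt_weightedMean_norm k hf (t, x)).comp_hasDerivAt_of_eq 0 hl (by simp)
  convert! h using 1
  simp [EuclideanSpace.inner_single_right]
  ring

theorem pdX_weightedMean_norm (k : ℕ) {f : ℝ → ℝ} (hf : ContDiff ℝ 2 f) (i : Fin 3) :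
    pdX i (fun t x => weightedMean k f t ‖x‖) =
      fun t x => x i * ((2 * (k + 1) : ℝ)⁻¹ * weightedMean (k + 1) (deriv (deriv f)) t ‖x‖) :=
  funext₂ fun t x => (hasDerivAt_weightedMean_norm_coord k hf t x i).deriv

theorem pdT_weightedMean_norm (k : ℕ) {f : ℝ → ℝ} (hf : ContDiff ℝ 2 f) :
    pdT (fun t (x : E3) => weightedMean k f t ‖x‖) = fun t x => weightedMean k (deriv f) t ‖x‖ := by
  funext t x
  have h := (hasFDerivAt_weightedMean_norm k hf (t, x)).comp_hasDerivAt t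
    ((hasDerivAt_id t).prodMk (hasDerivAt_const t x))
  simpa [pdT, Function.comp_def] using h.deriv

/-- Weighted means with `k = 0` solve the flat wave equation. -/
theorem pdT_pdT_weightedMean_norm {f : ℝ → ℝ} (hf : ContDiff ℝ ∞ f) (t : ℝ) (x : E3) :
    pdT (pdT fun t x => weightedMean 0 f t ‖x‖) t x =
      ∑ i, pdX i (pdX i fun t x => weightedMean 0 f t ‖x‖) t x := by
  have h2 : ∀ {g : ℝ → ℝ}, ContDiff ℝ ∞ g → ContDiff ℝ 2 g :=
    fun hg => contDiff_infty.1 hg 2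
  have hf' := (contDiff_infty_iff_deriv.1 hf).2
  have hf'' := (contDiff_infty_iff_deriv.1 hf').2
  have hX : ∀ i, pdX i (pdX i fun t x => weightedMean 0 f t ‖x‖) t x =
      2⁻¹ * weightedMean 1 (deriv (deriv f)) t ‖x‖ +
        x i ^ 2 * (8⁻¹ * weightedMean 2 (deriv (deriv (deriv (deriv f)))) t ‖x‖) := fun i => by
    rw [pdX_weightedMean_norm 0 (h2 hf)]
    have hc : HasDerivAt (fun s : ℝ => (x + s • EuclideanSpace.single i (1 : ℝ)) i) 1 0 := by
      simpa using (hasDerivAt_id (0 : ℝ)).const_add (x i)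
    have h := (hc.mul ((hasDerivAt_weightedMean_norm_coord 1 (h2 hf'') t x i).const_mul
      (2⁻¹ : ℝ))).deriv
    simp only [pdX, pdE, CharP.cast_eq_zero, zero_add, mul_one]
    refine h.trans ?_
    norm_num
    ring
  have hr := sq_mul_weightedMean_two (h2 hf'') t ‖x‖
  rw [EuclideanSpace.real_norm_sq_eq, Fin.sum_univ_three] at hr
  rw [pdT_weightedMean_norm 0 (h2 hf), pdT_weightedMean_norm 0 (h2 hf'), Fin.sum_univ_three,
    hX, hX, hX]
  linear_combination (-1 / 8 : ℝ) * hr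

/-- A field on `ℝ × ℝ³` that is jointly `C^∞`. -/
def SmoothField (u : ℝ → E3 → ℝ) : Prop :=
  ContDiff ℝ ∞ fun p : ℝ × E3 => u p.1 p.2

/-- The derivative of a field along a fixed spacetime vector. -/
def dirDeriv (v : ℝ × E3) (u : ℝ → E3 → ℝ) : ℝ → E3 → ℝ :=
  fun t x => fderiv ℝ (fun p : ℝ × E3 => u p.1 p.2) (t, x) v

/-- A field satisfying the flat wave equation. -/
def SolvesWave (u : ℝ → E3 → ℝ) : Prop :=
  ∀ t x, pdT (pdT u) t x = ∑ i, pdX i (pdX i u) t x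

/-- The spacetime coordinate vector of the `i`-th spatial direction. -/
def spaceVec (i : Fin 3) : ℝ × E3 := (0, EuclideanSpace.single i 1)

namespace SmoothField

variable {u : ℝ → E3 → ℝ}

theorem hasFDerivAt (hu : SmoothField u) (p : ℝ × E3) :
    HasFDerivAt (fun p : ℝ × E3 => u p.1 p.2) (fderiv ℝ (fun p : ℝ × E3 => u p.1 p.2) p) p :=
  ((ContDiff.differentiable hu (by simp)) p).hasFDerivAt

theorem pdT_eq (hu : SmoothField u) : pdT u = dirDeriv (1, 0) u :=
  funext₂ fun t x => ((hu.hasFDerivAt (t, x)).comp_hasDerivAt (f := fun s : ℝ => (s, x)) t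
    ((hasDerivAt_id' t).prodMk (hasDerivAt_const t x))).deriv

theorem pdX_eq (hu : SmoothField u) (i : Fin 3) : pdX i u = dirDeriv (spaceVec i) u := by
  funext t x
  have hl : HasDerivAt (fun s : ℝ => (t, x + s • EuclideanSpace.single i (1 : ℝ)))
      (spaceVec i) 0 :=
    (hasDerivAt_const _ _).prodMk
      (by simpa using ((hasDerivAt_id (0 : ℝ)).smul_const
        (EuclideanSpace.single i (1 : ℝ))).const_add x)
  exact ((hu.hasFDerivAt (t, x)).comp_hasDerivAt_of_eq 0 hl (by simp)).deriv

theorem dirDeriv (hu : SmoothField u) (v : ℝ × E3) : SmoothField (dirDeriv v u) :=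
  (ContDiff.fderiv_right hu (by simp)).clm_apply contDiff_const

theorem pdT (hu : SmoothField u) : SmoothField (pdT u) :=
  hu.pdT_eq ▸ hu.dirDeriv _

theorem pdX (hu : SmoothField u) (i : Fin 3) : SmoothField (pdX i u) :=
  hu.pdX_eq i ▸ hu.dirDeriv _

theorem sum {U : Fin 3 → ℝ → E3 → ℝ} (hU : ∀ j, SmoothField (U j)) :
    SmoothField fun t x => ∑ j, U j t x :=
  ContDiff.sum fun j _ => hU j

theorem dirDeriv_comm (hu : SmoothField u) (v w : ℝ × E3) :
    _root_.dirDeriv v (_root_.dirDeriv w u) = _root_.dirDeriv w (_root_.dirDeriv v u) := by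
  funext t x
  have hd : DifferentiableAt ℝ (fderiv ℝ fun p : ℝ × E3 => u p.1 p.2) (t, x) :=
    (ContDiff.fderiv_right (m := ∞) hu (by simp)).differentiable (by simp) _
  have hs : IsSymmSndFDerivAt ℝ (fun p : ℝ × E3 => u p.1 p.2) (t, x) :=
    (ContDiff.contDiffAt (contDiff_infty.1 hu 2)).isSymmSndFDerivAt (by simp)
  have key : ∀ a b : ℝ × E3, _root_.dirDeriv a (_root_.dirDeriv b u) t x =
      fderiv ℝ (fderiv ℝ fun p : ℝ × E3 => u p.1 p.2) (t, x) a b := fun a b => by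
    have := (hd.hasFDerivAt.clm_apply (hasFDerivAt_const b (t, x))).fderiv
    exact (congrArg (fun L : ℝ × E3 →L[ℝ] ℝ => L a) this).trans (by simp)
  rw [key, key, hs]

theorem dirDeriv_sum {U : Fin 3 → ℝ → E3 → ℝ} (hU : ∀ j, SmoothField (U j)) (v : ℝ × E3) :
    _root_.dirDeriv v (fun t x => ∑ j, U j t x) = fun t x => ∑ j, _root_.dirDeriv v (U j) t x := by
  funext t x
  have := (HasFDerivAt.fun_sum (u := Finset.univ) fun j _ => (hU j).hasFDerivAt (t, x)).fderiv
  exact (congrArg (fun L : ℝ × E3 →L[ℝ] ℝ => L v) this).trans (by simp [_root_.dirDeriv])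

theorem pdT_pdX_comm (hu : SmoothField u) (i : Fin 3) :
    _root_.pdT (_root_.pdX i u) = _root_.pdX i (_root_.pdT u) := by
  rw [(hu.pdX i).pdT_eq, hu.pdT.pdX_eq, hu.pdX_eq, hu.pdT_eq, hu.dirDeriv_comm]

theorem pdX_comm (hu : SmoothField u) (i j : Fin 3) :
    _root_.pdX i (_root_.pdX j u) = _root_.pdX j (_root_.pdX i u) := by
  rw [(hu.pdX j).pdX_eq, (hu.pdX i).pdX_eq, hu.pdX_eq, hu.pdX_eq, hu.dirDeriv_comm]

theorem pdT_sum {U : Fin 3 → ℝ → E3 → ℝ} (hU : ∀ j, SmoothField (U j)) :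
    _root_.pdT (fun t x => ∑ j, U j t x) = fun t x => ∑ j, _root_.pdT (U j) t x := by
  simp only [(sum hU).pdT_eq, dirDeriv_sum hU, fun j => (hU j).pdT_eq]

theorem pdX_sum {U : Fin 3 → ℝ → E3 → ℝ} (hU : ∀ j, SmoothField (U j)) (i : Fin 3) :
    _root_.pdX i (fun t x => ∑ j, U j t x) = fun t x => ∑ j, _root_.pdX i (U j) t x := by
  simp only [(sum hU).pdX_eq, dirDeriv_sum hU, fun j => (hU j).pdX_eq]

end SmoothField

namespace SolvesWave

variable {u : ℝ → E3 → ℝ}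

theorem sum {U : Fin 3 → ℝ → E3 → ℝ} (hU : ∀ j, SmoothField (U j))
    (hw : ∀ j, SolvesWave (U j)) : SolvesWave fun t x => ∑ j, U j t x := by
  intro t x
  simp only [SmoothField.pdT_sum hU, SmoothField.pdT_sum fun j => (hU j).pdT,
    SmoothField.pdX_sum hU, SmoothField.pdX_sum fun j => (hU j).pdX _]
  rw [Finset.sum_comm]
  exact Finset.sum_congr rfl fun j _ => hw j t x

theorem pdT (hu : SmoothField u) (hw : SolvesWave u) : SolvesWave (pdT u) := by
  intro t x
  rw [show _root_.pdT (_root_.pdT u) = _ from funext₂ hw,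
    SmoothField.pdT_sum fun i => (hu.pdX i).pdX i]
  refine Finset.sum_congr rfl fun i _ => ?_
  rw [(hu.pdX i).pdT_pdX_comm, hu.pdT_pdX_comm]

theorem pdX (hu : SmoothField u) (hw : SolvesWave u) (j : Fin 3) : SolvesWave (pdX j u) := by
  intro t x
  rw [hu.pdT_pdX_comm, hu.pdT.pdT_pdX_comm, show _root_.pdT (_root_.pdT u) = _ from funext₂ hw,
    SmoothField.pdX_sum fun i => (hu.pdX i).pdX i]
  refine Finset.sum_congr rfl fun i _ => ?_
  rw [(hu.pdX i).pdX_comm, hu.pdX_comm j i]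

end SolvesWave

theorem smoothField_sphericalWave {f : ℝ → ℝ} (hf : ContDiff ℝ ∞ f) :
    SmoothField (sphericalWave f) := by
  rw [sphericalWave_eq_neg_weightedMean (contDiff_infty.1 hf 1)]
  exact (contDiff_weightedMean_norm 0 (contDiff_infty_iff_deriv.1 hf).2).neg

theorem solvesWave_sphericalWave {f : ℝ → ℝ} (hf : ContDiff ℝ ∞ f) :
    SolvesWave (sphericalWave f) := by
  intro t x
  have h := pdT_pdT_weightedMean_norm (contDiff_infty_iff_deriv.1 hf).2 t x
  rw [sphericalWave_eq_neg_weightedMean (contDiff_infty.1 hf 1)]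
  simp only [pdT, pdX, pdE, deriv.fun_neg, Finset.sum_neg_distrib] at h ⊢
  rw [h]

/-- all Blanchet–Damour components are `C^∞` on `ℝ × ℝ³`, each
satisfies the flat wave equation `∂ₜ²h̄_{μν} = Σᵢ ∂ᵢ²h̄_{μν}`, and the harmonic
(de Donder) gauge conditions `∂ₜh̄_{tt} = Σᵢ ∂ᵢh̄_{it}` and
`∂ₜh̄_{tk} = Σᵢ ∂ᵢh̄_{ik}` hold; hence the Blanchet–Damour fields are smooth
solutions of the linearised vacuum Einstein equations on Minkowski spacetime in
harmonic coordinates. -/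
theorem blanchet_damour_solution (I : ℝ → Fin 3 → Fin 3 → ℝ)
    (hI : ContDiff ℝ (⊤ : ℕ∞) I) (hIsymm : ∀ s i j, I s i j = I s j i) :
    (ContDiff ℝ (⊤ : ℕ∞) fun p : ℝ × E3 => BDtt I p.1 p.2)
    ∧ (∀ j, ContDiff ℝ (⊤ : ℕ∞) fun p : ℝ × E3 => BDtj I j p.1 p.2)
    ∧ (∀ j k, ContDiff ℝ (⊤ : ℕ∞) fun p : ℝ × E3 => BDjk I j k p.1 p.2)
    ∧ (∀ t x, pdT (pdT (BDtt I)) t x = ∑ i, pdX i (pdX i (BDtt I)) t x)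
    ∧ (∀ j t x, pdT (pdT (BDtj I j)) t x = ∑ i, pdX i (pdX i (BDtj I j)) t x)
    ∧ (∀ j k t x, pdT (pdT (BDjk I j k)) t x = ∑ i, pdX i (pdX i (BDjk I j k)) t x)
    ∧ (∀ t x, pdT (BDtt I) t x = ∑ i, pdX i (BDtj I i) t x)
    ∧ (∀ k t x, pdT (BDtj I k) t x = ∑ i, pdX i (BDjk I i k) t x) := by
  have hf : ∀ i j, ContDiff ℝ ∞ fun s => I s i j := fun i j =>
    contDiff_pi.1 (contDiff_pi.1 hI i) j
  have hF : ∀ i j, SmoothField (BDF I i j) := fun i j => smoothField_sphericalWave (hf i j)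
  have hW : ∀ i j, SolvesWave (BDF I i j) := fun i j => solvesWave_sphericalWave (hf i j)
  have htt : ∀ i j, SmoothField (pdX i (pdX j (BDF I i j))) := fun i j => ((hF i j).pdX j).pdX i
  have htj : ∀ i j, SmoothField (pdX i (pdT (BDF I i j))) := fun i j => (hF i j).pdT.pdX i
  have htj_eq : ∀ j, BDtj I j = fun t x => ∑ i, pdX i (pdT (BDF I i j)) t x := fun _ => rfl
  refine ⟨SmoothField.sum fun i => SmoothField.sum (htt i),
    fun j => SmoothField.sum fun i => htj i j, fun j k => (hF j k).pdT.pdT,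
    SolvesWave.sum (fun i => SmoothField.sum (htt i)) fun i => SolvesWave.sum (htt i) fun j =>
      ((hW i j).pdX (hF i j) j).pdX ((hF i j).pdX j) i,
    fun j => SolvesWave.sum (fun i => htj i j) fun i =>
      ((hW i j).pdT (hF i j)).pdX (hF i j).pdT i,
    fun j k => ((hW j k).pdT (hF j k)).pdT (hF j k).pdT, fun t x => ?_, fun k t x => ?_⟩
  · rw [show BDtt I = fun t x => ∑ i, ∑ j, pdX i (pdX j (BDF I i j)) t x from rfl]
    simp only [htj_eq, SmoothField.pdT_sum fun i => SmoothField.sum (htt i),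
      fun i => SmoothField.pdT_sum (htt i), fun j i => SmoothField.pdX_sum (fun i => htj i j) i]
    rw [Finset.sum_comm]
    refine Finset.sum_congr rfl fun j _ => Finset.sum_congr rfl fun i _ => ?_
    rw [((hF i j).pdX j).pdT_pdX_comm, (hF i j).pdT_pdX_comm, (hF i j).pdT.pdX_comm]
  · simp only [htj_eq, BDjk, SmoothField.pdT_sum fun i => htj i k]
    exact Finset.sum_congr rfl fun i _ => by rw [(hF i k).pdT.pdT_pdX_comm]
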